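/- If each of finitely many given subsets of ℤ^d possesses an affine stratification, then their union also possesses an affine stratification. -/

import Mathlib

open Pointwise

/-- An affine stratification of `W ⊆ ℤ^d`: a finite partition of `W` into pairwise
disjoint sets, each of the form `F + A` for a finite set `F ⊆ ℤ^d` and a finitely
generated submonoid (affine semigroup) `A ⊆ ℤ^d`. -/
def IsAffineStratification {d : ℕ} (W : Set (Fin d → ℤ)) : Prop :=
  ∃ (r : ℕ) (F : Fin r → Finset (Fin d → ℤ)) (A : Fin r → AddSubmonoid (Fin d → ℤ)),
    (∀ i, (A i).FG) ∧
    (Pairwise fun i j => Disjoint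
      ((F i : Set (Fin d → ℤ)) + (A i : Set (Fin d → ℤ)))
      ((F j : Set (Fin d → ℤ)) + (A j : Set (Fin d → ℤ)))) ∧
    W = ⋃ i, ((F i : Set (Fin d → ℤ)) + (A i : Set (Fin d → ℤ)))

/-! ### Finite disjoint unions -/

/-- A set is a finite disjoint union of sets satisfying `P`. -/
inductive FiniteDisjointUnion {α : Type*} (P : Set α → Prop) : Set α → Prop
  | empty : FiniteDisjointUnion P ∅
  | cons {X Y : Set α} (hX : P X) (hY : FiniteDisjointUnion P Y) (hXY : Disjoint X Y) :
      FiniteDisjointUnion P (X ∪ Y)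

namespace FiniteDisjointUnion

variable {α β : Type*} {P : Set α → Prop} {Q : Set β → Prop}

theorem of_prop {X : Set α} (hX : P X) : FiniteDisjointUnion P X := by
  simpa using cons hX empty (Set.disjoint_empty X)

theorem union {X Y : Set α} (hX : FiniteDisjointUnion P X) (hY : FiniteDisjointUnion P Y)
    (hXY : Disjoint X Y) : FiniteDisjointUnion P (X ∪ Y) := by
  induction hX with
  | empty => simpa
  | cons hA _ hAB ih =>
    rw [Set.disjoint_union_left] at hXY
    rw [Set.union_assoc]
    exact cons hA (ih hXY.2) (Set.disjoint_union_right.2 ⟨hAB, hXY.1⟩)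

theorem biUnion {ι : Type*} {s : Finset ι} {f : ι → Set α}
    (hf : ∀ i ∈ s, FiniteDisjointUnion P (f i)) (hs : (s : Set ι).PairwiseDisjoint f) :
    FiniteDisjointUnion P (⋃ i ∈ s, f i) := by
  classical
  induction s using Finset.induction_on with
  | empty => simpa using empty
  | insert a s ha ih =>
    rw [Finset.set_biUnion_insert]
    refine (hf a (by simp)).union (ih (fun i hi => hf i (by simp [hi]))
      (hs.subset (by simp))) ?_
    simp only [Set.disjoint_iUnion_right]
    intro i hi
    exact hs (by simp) (by simp [hi]) (by rintro rfl; exact ha hi)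

theorem image {X : Set α} {g : α → β} (hX : FiniteDisjointUnion P X) (hg : Set.InjOn g X)
    (h : ∀ Y, P Y → Set.InjOn g Y → FiniteDisjointUnion Q (g '' Y)) :
    FiniteDisjointUnion Q (g '' X) := by
  induction hX with
  | empty => simpa using empty
  | cons hA _ hAB ih =>
    rw [Set.image_union]
    exact (h _ hA (hg.mono Set.subset_union_left)).union
      (ih (hg.mono Set.subset_union_right))
      (by rw [Set.disjoint_iff_inter_eq_empty, ← Set.InjOn.image_inter hg Set.subset_union_left
        Set.subset_union_right, hAB.inter_eq, Set.image_empty])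

theorem inter {P' : Set α → Prop} {X : Set α} (hX : FiniteDisjointUnion P X) (C : Set α)
    (h : ∀ Y, P Y → P' (Y ∩ C)) : FiniteDisjointUnion P' (X ∩ C) := by
  induction hX with
  | empty => simpa using empty
  | cons hA _ hAB ih =>
    rw [Set.union_inter_distrib_right]
    exact cons (h _ hA) ih (hAB.mono Set.inter_subset_left Set.inter_subset_left)

theorem bind {P' : Set α → Prop} {X : Set α} (hX : FiniteDisjointUnion P X)
    (h : ∀ Y, P Y → FiniteDisjointUnion P' Y) : FiniteDisjointUnion P' X := by
  induction hX with
  | empty => exact empty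
  | cons hA _ hAB ih => exact (h _ hA).union ih hAB

end FiniteDisjointUnion

/-! ### Slices -/

/-- A set `s` is a slice if `a + b + c ∈ s` whenever `a`, `a + b` and `a + c` lie in `s`. -/
def IsSlice {M : Type*} [Add M] (s : Set M) : Prop :=
  ∀ a ∈ s, ∀ b c, a + b ∈ s → a + c ∈ s → a + b + c ∈ s

namespace IsSlice

theorem sep_apply_eq {ι : Type*} {s : Set (ι → ℕ)} (hs : IsSlice s) (i : ι) (a : ℕ) :
    IsSlice {x ∈ s | x i = a} := by
  rintro x ⟨hx, hxi⟩ y z ⟨hxy, hxyi⟩ ⟨hxz, hxzi⟩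
  refine ⟨hs _ hx _ _ hxy hxz, ?_⟩
  simp only [Pi.add_apply] at *
  omega

theorem sep_le_apply {ι : Type*} {s : Set (ι → ℕ)} (hs : IsSlice s) (i : ι) (a : ℕ) :
    IsSlice {x ∈ s | a ≤ x i} := by
  rintro x ⟨hx, hxi⟩ y z ⟨hxy, hxyi⟩ ⟨hxz, hxzi⟩
  refine ⟨hs _ hx _ _ hxy hxz, ?_⟩
  simp only [Pi.add_apply] at *
  omega

open AddSubmonoid in
/-- Some principal upper part of a nonempty slice is a linear set. -/
theorem exists_isLinearSet_sep_le {M : Type*} [AddCommMonoid M] [PartialOrder M]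
    [WellQuasiOrderedLE M] [IsOrderedCancelAddMonoid M] [CanonicallyOrderedAdd M] {s : Set M}
    (hs : IsSlice s) (hs' : s.Nonempty) : ∃ x ∈ s, IsLinearSet {y ∈ s | x ≤ y} := by
  classical
  let f (x : M) : AddSubmonoid M :=
    if hx : x ∈ s then
      { carrier := { y | x + y ∈ s }
        zero_mem' := by simpa
        add_mem' := by
          intro a b ha hb
          simp only [Set.mem_ofPred_eq] at *
          rw [← add_assoc]
          exact hs _ hx _ _ ha hb }
    else ⊥
  have hf : ∀ x ∈ s, ∀ y, y ∈ f x ↔ x + y ∈ s := by simp_all [f]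
  let g (x : M) : AddSemigroupIdeal M := .closure (f x \ {0})
  have hg : ∀ x ∈ s, ∀ y ∈ s, x ≤ y → g x ≤ g y := by
    intro x hx y hy hxy z hz
    rw [le_iff_exists_add] at hxy
    rcases hxy with ⟨y, rfl⟩
    simp only [AddSemigroupIdeal.mem_closure'', Set.mem_sdiff, SetLike.mem_coe,
      Set.mem_singleton_iff, g] at hz ⊢
    rcases hz with ⟨y', z, ⟨hz₁, hz₂⟩, rfl⟩
    rw [hf _ hx] at hz₁
    refine ⟨y', z, ⟨?_, hz₂⟩, rfl⟩
    rw [hf _ hy]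
    exact hs _ hx _ _ hy hz₁
  rcases exists_maximalFor_of_wellFoundedGT (· ∈ s) g hs' with ⟨a, ha⟩
  refine ⟨a, ha.1, ?_⟩
  convert_to IsLinearSet (a +ᵥ (f a : Set M))
  · ext x
    simp only [le_iff_exists_add, Set.mem_ofPred_eq, ha.1, ↓reduceDIte, coe_set_mk,
      AddSubsemigroup.coe_set_mk, Set.mem_vadd_set, vadd_eq_add, f]
    grind
  · refine IsLinearSet.vadd a (.of_fg (AddSubmonoid.fg_of_subtractive ?_))
    intro x hx y hxy
    rw [hf _ ha.1] at hx
    rw [hf _ ha.1, ← add_assoc] at hxy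
    by_cases hy : y = 0
    · simp [hy]
    replace hy : y ∈ g (a + x) := by
      apply AddSemigroupIdeal.subset_closure
      refine Set.mem_sdiff_of_mem ?_ hy
      rwa [SetLike.mem_coe, hf _ hx]
    apply ha.2 hx (hg _ ha.1 _ hx le_self_add) at hy
    simp only [g, AddSemigroupIdeal.mem_closure'', Set.mem_sdiff, SetLike.mem_coe,
      Set.notMem_singleton_iff] at hy
    rcases hy with ⟨w, u, ⟨hu₁, hu₂⟩, rfl⟩
    induction w using WellQuasiOrderedLE.to_wellFoundedLT.induction (α := M) generalizing u with
      | _ w ih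
    by_cases hw₁ : w = 0
    · simpa [hw₁]
    have hxu : a + x + u ∈ s := hs _ ha.1 _ _ hx (by rwa [hf _ ha.1] at hu₁)
    have hw₂ : w ∈ g (a + x + u) := by
      apply AddSemigroupIdeal.subset_closure
      refine Set.mem_sdiff_of_mem ?_ hw₁
      rwa [SetLike.mem_coe, hf _ hxu, add_assoc, add_comm u w]
    apply ha.2 hxu (hg _ ha.1 _ hxu (le_add_right le_self_add)) at hw₂
    simp only [g, AddSemigroupIdeal.mem_closure'', Set.mem_sdiff, SetLike.mem_coe,
      Set.notMem_singleton_iff] at hw₂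
    rcases hw₂ with ⟨v, u', ⟨hu'₁, hu'₂⟩, rfl⟩
    rw [add_assoc]
    apply ih
    · exact lt_add_of_pos_right _ (pos_of_ne_zero hu'₂)
    · exact add_mem hu'₁ hu₁
    · simp [hu₂, hu'₂]
    · rwa [← add_assoc v]

/-- If, for every slice contained in `s`, the fibres of the coordinates in `t` decompose, then so
does the part of the slice `s` not dominating `x` on `t`. -/
theorem finiteDisjointUnion_sep_not_le {ι : Type*} {P : Set (ι → ℕ) → Prop} {s : Set (ι → ℕ)}
    (x : ι → ℕ) (t : Finset ι)
    (h : ∀ s' ⊆ s, IsSlice s' → ∀ i ∈ t, ∀ j, FiniteDisjointUnion P {y ∈ s' | y i = j})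
    (hs : IsSlice s) : FiniteDisjointUnion P {y ∈ s | ¬ ∀ i ∈ t, x i ≤ y i} := by
  classical
  induction t using Finset.induction_on generalizing s with
  | empty => simpa using FiniteDisjointUnion.empty
  | insert i t hi ih =>
    convert_to FiniteDisjointUnion P ((⋃ j ∈ Finset.range (x i), {y ∈ s | y i = j}) ∪
      {y ∈ {y ∈ s | x i ≤ y i} | ¬ ∀ k ∈ t, x k ≤ y k})
    · ext y
      simp only [Set.mem_ofPred_eq, Finset.forall_mem_insert, Finset.mem_range, Set.mem_union,
        Set.mem_iUnion]
      grind
    · refine .union (.biUnion (fun j _ => h s subset_rfl hs i (by simp) j) ?_)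
        (ih (fun s' hs' hs'' k hk => h s' (hs'.trans (Set.sep_subset _ _)) hs'' k (by simp [hk]))
          (hs.sep_le_apply i (x i))) ?_
      · intro j _ k _ hjk
        rw [Function.onFun, Set.disjoint_left]
        rintro y ⟨_, hy⟩ ⟨_, hy'⟩
        exact hjk (hy.symm.trans hy')
      · rw [Set.disjoint_left]
        intro y hy hy'
        simp only [Set.mem_iUnion, Finset.mem_range, Set.mem_ofPred_eq] at hy hy'
        grind

/-- A slice of `ℕ ^ ι` is a finite disjoint union of linear sets. -/
theorem finiteDisjointUnion {ι : Type*} [Finite ι] {s : Set (ι → ℕ)} (hs : IsSlice s) :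
    FiniteDisjointUnion IsLinearSet s := by
  classical
  suffices h : ∀ (a : ι → ℕ) (t : Finset ι), (∀ x ∈ s, ∀ i ∉ t, x i = a i) →
      FiniteDisjointUnion IsLinearSet s by
    have := Fintype.ofFinite ι
    exact h 0 Finset.univ (by simp)
  intro a t ht
  induction t using Finset.strongInductionOn generalizing s a with | _ t ih
  obtain rfl | hs' := s.eq_empty_or_nonempty
  · exact .empty
  rcases hs.exists_isLinearSet_sep_le hs' with ⟨x, hx, hx'⟩
  convert_to FiniteDisjointUnion IsLinearSet ({y ∈ s | x ≤ y} ∪ {y ∈ s | ¬ ∀ i ∈ t, x i ≤ y i})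
  · ext y
    simp only [Set.mem_union, Set.mem_ofPred_eq, Pi.le_def]
    grind
  · refine .cons hx' (finiteDisjointUnion_sep_not_le x t (fun s' hs' hs'' i hi j => ?_) hs) ?_
    · apply ih _ (Finset.erase_ssubset hi) (hs''.sep_apply_eq _ _) (Function.update a i j)
      grind [Function.update]
    · rw [Set.disjoint_left]
      rintro y ⟨_, hy⟩ ⟨_, hy'⟩
      exact hy' fun i _ => hy i

end IsSlice

/-! ### Injective images of slices -/

variable {M : Type*}

/-- A set is a slice image if it is the image of a slice of some `ℕ ^ ι` under an additive
homomorphism that is injective on this slice. -/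
def IsSliceImage [AddCommMonoid M] (X : Set M) : Prop :=
  ∃ (ι : Type) (_ : Finite ι) (S : Set (ι → ℕ)) (f : (ι → ℕ) →+ M),
    IsSlice S ∧ Set.InjOn f S ∧ X = f '' S

theorem IsSliceImage.finiteDisjointUnion [AddCommMonoid M] {X : Set M} (hX : IsSliceImage X) :
    FiniteDisjointUnion IsLinearSet X := by
  obtain ⟨ι, _, S, f, hS, hf, rfl⟩ := hX
  exact hS.finiteDisjointUnion.image hf fun Y hY _ => .of_prop (hY.image f)

/-- The set of points where an integer-valued homomorphism takes its value in the arithmetic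
progression of initial term `c` and difference `e`. -/
def progressionPreimage [AddCommMonoid M] (l : M →+ ℤ) (c e : ℤ) : Set M :=
  {x | ∃ k : ℕ, l x = c + e * k}

theorem IsSliceImage.inter_progressionPreimage [AddCommMonoid M] {X : Set M} (hX : IsSliceImage X)
    (l : M →+ ℤ) (c : ℤ) {e : ℤ} (he : e ≠ 0) :
    IsSliceImage (X ∩ progressionPreimage l c e) := by
  obtain ⟨ι, _, S, f, hS, hf, rfl⟩ := hX
  refine ⟨Option ι, inferInstance, {s | s ∘ some ∈ S ∧ l (f (s ∘ some)) = c + e * s none},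
    f.comp (LinearMap.funLeft ℕ ℕ some).toAddMonoidHom, ?_, ?_, ?_⟩
  · rintro a ⟨ha, ha'⟩ b b' ⟨hb, hb'⟩ ⟨hb₁, hb₁'⟩
    refine ⟨hS _ ha _ _ hb hb₁, ?_⟩
    simp only [Pi.add_comp, map_add, Pi.add_apply, Nat.cast_add] at *
    linear_combination hb' + hb₁' - ha'
  · rintro a ⟨ha, ha'⟩ b ⟨hb, hb'⟩ hab
    have hab' : a ∘ some = b ∘ some := hf ha hb hab
    funext i
    cases i with
    | none =>
      rw [hab', hb'] at ha'
      have := mul_left_cancel₀ he (add_left_cancel ha')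
      exact_mod_cast this.symm
    | some i => exact congrFun hab' i
  · ext x
    constructor
    · rintro ⟨⟨s, hs, rfl⟩, k, hk⟩
      exact ⟨fun i => i.elim k s, ⟨hs, hk⟩, rfl⟩
    · rintro ⟨s, ⟨hs, hk⟩, rfl⟩
      exact ⟨⟨_, hs, rfl⟩, _, hk⟩

namespace FiniteDisjointUnion

variable [AddCommMonoid M]

theorem sdiff_progressionPreimage {X : Set M} (hX : FiniteDisjointUnion IsSliceImage X)
    (l : M →+ ℤ) (c : ℤ) {N : ℕ} (hN : 0 < N) :
    FiniteDisjointUnion IsSliceImage (X \ progressionPreimage l c N) := by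
  have hN' : (0 : ℤ) < N := by exact_mod_cast hN
  convert_to FiniteDisjointUnion IsSliceImage (X ∩ progressionPreimage l (c - 1) (-1) ∪
    ⋃ r ∈ (Finset.range N).erase 0, X ∩ progressionPreimage l (c + (r : ℕ)) N)
  · ext x
    simp only [progressionPreimage, Set.mem_sdiff, Set.mem_union, Set.mem_inter_iff,
      Set.mem_iUnion, Set.mem_ofPred_eq, Finset.mem_erase, Finset.mem_range]
    constructor
    · rintro ⟨hx, hl⟩
      by_cases hc : l x < c
      · exact .inl ⟨hx, (c - 1 - l x).toNat, by omega⟩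
      · have hq : 0 ≤ (l x - c) / N := Int.ediv_nonneg (by omega) hN'.le
        have hr := Int.emod_nonneg (l x - c) hN'.ne'
        have hr' := Int.emod_lt_of_pos (l x - c) hN'
        have hqr := Int.mul_ediv_add_emod (l x - c) N
        refine .inr ⟨((l x - c) % N).toNat, ⟨fun h0 => hl ?_, by omega⟩, hx,
          ((l x - c) / N).toNat, ?_⟩
        · refine ⟨((l x - c) / N).toNat, ?_⟩
          rw [Int.toNat_of_nonneg hq]
          omega
        · rw [Int.toNat_of_nonneg hq, Int.toNat_of_nonneg hr]
          omega
    · rintro (⟨hx, k, hk⟩ | ⟨r, ⟨hr, hr'⟩, hx, k, hk⟩) <;> refine ⟨hx, ?_⟩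
      · rintro ⟨k', hk'⟩
        have : (0 : ℤ) ≤ N * k' := by positivity
        omega
      · rintro ⟨k', hk'⟩
        have h : (r : ℤ) = N * (k' - k) := by linear_combination hk' - hk
        have hd : (N : ℤ) ∣ r := ⟨_, h⟩
        exact hr (Nat.eq_zero_of_dvd_of_lt (by exact_mod_cast hd) hr')
  · refine .union (hX.inter _ fun Y hY => hY.inter_progressionPreimage l _ (by simp))
      (.biUnion (fun r _ => hX.inter _ fun Y hY => hY.inter_progressionPreimage l _ hN'.ne') ?_) ?_
    · intro r hr r' hr' hrr'
      simp only [Finset.coe_erase, Finset.coe_range, Set.mem_sdiff, Set.mem_Iio] at hr hr'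
      rw [Function.onFun, Set.disjoint_left]
      rintro x ⟨_, k, hk⟩ ⟨_, k', hk'⟩
      have h : ((r : ℤ) - r') = N * (k' - k) := by linear_combination hk' - hk
      have : r' ≡ r [MOD N] := (Nat.modEq_iff_dvd).2 ⟨_, h⟩
      exact hrr' (this.symm.eq_of_lt_of_lt hr.1 hr'.1)
    · simp only [Set.disjoint_iUnion_right]
      intro r _
      rw [Set.disjoint_left]
      rintro x ⟨_, k, hk⟩ ⟨_, k', hk'⟩
      have : (0 : ℤ) ≤ N * k' := by positivity
      omega

theorem sdiff_iInter_progressionPreimage {J : Type*} {X : Set M}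
    (hX : FiniteDisjointUnion IsSliceImage X) (l : J → M →+ ℤ) (c : J → ℤ) {N : ℕ} (hN : 0 < N)
    (s : Finset J) :
    FiniteDisjointUnion IsSliceImage (X \ ⋂ j ∈ s, progressionPreimage (l j) (c j) N) := by
  classical
  induction s using Finset.induction_on generalizing X with
  | empty => simpa using empty
  | insert j s hj ih =>
    have hXj : FiniteDisjointUnion IsSliceImage (X ∩ progressionPreimage (l j) (c j) N) :=
      hX.inter _ fun Y hY => hY.inter_progressionPreimage _ _ (by exact_mod_cast hN.ne')
    convert_to FiniteDisjointUnion IsSliceImage ((X \ progressionPreimage (l j) (c j) N) ∪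
      ((X ∩ progressionPreimage (l j) (c j) N) \ ⋂ j ∈ s, progressionPreimage (l j) (c j) N))
    · rw [Finset.set_biInter_insert]
      ext x
      simp only [Set.mem_sdiff, Set.mem_union, Set.mem_inter_iff]
      tauto
    · refine (hX.sdiff_progressionPreimage _ _ hN).union (ih hXj) ?_
      rw [Set.disjoint_left]
      rintro x ⟨_, hx⟩ ⟨⟨_, hx'⟩, _⟩
      exact hx hx'

end FiniteDisjointUnion

/-- `ℤ ^ d` is the finite disjoint union of its orthants. -/
theorem finiteDisjointUnion_isSliceImage_univ (d : ℕ) :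
    FiniteDisjointUnion IsSliceImage (Set.univ : Set (Fin d → ℤ)) := by
  classical
  let C (T : Finset (Fin d)) : Set (Fin d → ℤ) := {x | ∀ i, i ∈ T ↔ 0 ≤ x i}
  convert_to FiniteDisjointUnion IsSliceImage (⋃ T ∈ (Finset.univ : Finset (Finset (Fin d))), C T)
  · ext x
    simp only [Finset.mem_univ, Set.iUnion_true, Set.mem_iUnion, Set.mem_univ, true_iff]
    exact ⟨Finset.univ.filter fun i => 0 ≤ x i, by simp [C]⟩
  refine .biUnion (fun T _ => .of_prop ?_) ?_
  · let f : (Fin d → ℕ) →+ (Fin d → ℤ) :=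
      { toFun n i := if i ∈ T then (n i : ℤ) else -(n i : ℤ)
        map_zero' := by ext; simp
        map_add' a b := by ext i; by_cases hi : i ∈ T <;> simp [hi]; ring }
    have hf (n i) : f n i = if i ∈ T then (n i : ℤ) else -(n i : ℤ) := rfl
    refine ⟨Fin d, inferInstance, {n | ∀ i ∉ T, 1 ≤ n i}, f, ?_, ?_, ?_⟩
    · intro a ha b c _ _ i hi
      have := ha i hi
      simp only [Pi.add_apply]
      omega
    · intro a _ b _ hab
      funext i
      have := congrFun hab i
      rw [hf, hf] at this
      grind
    · ext x
      constructor
      · intro hx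
        refine ⟨fun i => (x i).natAbs, fun i hi => ?_, ?_⟩
        · have := hx i
          grind
        · funext i
          have := hx i
          rw [hf]
          grind
      · rintro ⟨n, hn, rfl⟩ i
        have := hn i
        rw [hf]
        grind
  · intro T _ T' _ hTT'
    rw [Function.onFun, Set.disjoint_left]
    intro x hx hy
    exact hTT' (Finset.ext fun i => (hx i).trans (hy i).symm)

/-! ### Proper linear sets of `ℤ ^ d` -/

section ProperLinear

variable {d : ℕ}

/-- The inclusion of `ℤ ^ d` into `ℚ ^ d`. -/
def intVecToRat (d : ℕ) : (Fin d → ℤ) →+ (Fin d → ℚ) :=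
  (Int.castAddHom ℚ).compLeft (Fin d)

theorem intVecToRat_injective : Function.Injective (intVecToRat d) := by
  intro x y h
  ext i
  simpa [intVecToRat] using congrFun h i

theorem linearIndepOn_intVecToRat {s : Set (Fin d → ℤ)} (hs : LinearIndepOn ℕ id s) :
    LinearIndepOn ℚ (intVecToRat d) s := by
  rw [LinearIndepOn, ← LinearIndependent.iff_fractionRing ℤ ℚ, ← LinearIndepOn, linearIndepOn_iff'']
  intro t f ht hf heq i hi
  rw [linearIndepOn_iff_linearIndepOn_finset] at hs
  specialize hs t ht
  rw [linearIndepOn_finset_iffₛ] at hs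
  specialize hs (Int.toNat ∘ f) (Int.toNat ∘ (-·) ∘ f) ?_ i hi
  · apply intVecToRat_injective
    simp_rw [map_sum]
    rw [← sub_eq_zero, ← Finset.sum_sub_distrib, ← heq]
    refine Finset.sum_congr rfl fun j hj => ?_
    conv_rhs => rw [← (f j).toNat_sub_toNat_neg]
    simp only [sub_smul, map_nsmul, natCast_zsmul, Function.comp_apply, id_eq]
  · rw [← (f i).toNat_sub_toNat_neg, sub_eq_zero, Int.natCast_inj]
    simpa using hs

/-- Up to a common denominator, finitely many rational linear forms take integer values on
`ℤ ^ d`. -/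
theorem exists_intValued_multiple {E : Type*} [Finite E] (q : E → (Fin d → ℚ) →ₗ[ℚ] ℚ) :
    ∃ (N : ℕ) (l : E → (Fin d → ℤ) →+ ℤ), 0 < N ∧
      ∀ i x, (l i x : ℚ) = N * q i (intVecToRat d x) := by
  classical
  have := Fintype.ofFinite E
  let r (p : E × Fin d) : ℚ := q p.1 (Pi.single p.2 1)
  let N : ℕ := ∏ p, (r p).den
  have hr (p) : ∃ m : ℤ, N * r p = m := by
    obtain ⟨c, hc⟩ : (r p).den ∣ N := Finset.dvd_prod_of_mem _ (Finset.mem_univ p)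
    refine ⟨(r p).num * c, ?_⟩
    rw [hc]
    push_cast
    linear_combination c * Rat.mul_den_eq_num (r p)
  choose m hm using hr
  refine ⟨N, fun i => AddMonoidHom.mk' (fun x => ∑ k, x k * m (i, k))
    (by simp [add_mul, Finset.sum_add_distrib]), Finset.prod_pos fun p _ => (r p).den_pos, ?_⟩
  intro i x
  rw [LinearMap.pi_apply_eq_sum_univ (q i), Finset.mul_sum]
  simp only [AddMonoidHom.mk'_apply, Int.cast_sum, Int.cast_mul, ← hm, r]
  refine Finset.sum_congr rfl fun k _ => ?_
  have : (Pi.single k 1 : Fin d → ℚ) = fun j => if k = j then 1 else 0 := by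
    ext j
    simp [Pi.single_apply, eq_comm]
  simp only [this, intVecToRat, AddMonoidHom.compLeft_apply, Function.comp_apply,
    Int.coe_castAddHom, smul_eq_mul]
  ring

open AddSubmonoid in
theorem exists_closure_eq_iInter_progressionPreimage {t : Set (Fin d → ℤ)}
    (ht : LinearIndepOn ℕ id t) :
    ∃ (J : Type) (_ : Fintype J) (l : J → (Fin d → ℤ) →+ ℤ) (N : ℕ), 0 < N ∧
      (AddSubmonoid.closure t : Set (Fin d → ℤ)) = ⋂ j, progressionPreimage (l j) 0 N := by
  classical
  have hv := (linearIndepOn_intVecToRat ht).id_image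
  let b := Module.Basis.extend hv
  have : Finite (hv.extend (Set.subset_univ _)) := Module.Finite.finite_basis b
  have := Fintype.ofFinite (hv.extend (Set.subset_univ _))
  obtain ⟨N, l, hN, hl⟩ := exists_intValued_multiple fun i => b.coord i
  have hN' : (N : ℚ) ≠ 0 := by exact_mod_cast hN.ne'
  refine ⟨_ ⊕ _, inferInstance,
    Sum.elim l fun i => if i.1 ∈ intVecToRat d '' t then 0 else -l i, N, hN, ?_⟩
  ext x
  simp only [SetLike.mem_coe, Set.mem_iInter, progressionPreimage, Set.mem_ofPred_eq, zero_add]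
  constructor
  · intro hx j
    induction hx using closure_induction with
    | zero => exact ⟨0, by simp⟩
    | add x y _ _ hx hy =>
      obtain ⟨k, hk⟩ := hx
      obtain ⟨k', hk'⟩ := hy
      exact ⟨k + k', by rw [map_add, hk, hk']; push_cast; ring⟩
    | mem x hx =>
      have hxt : intVecToRat d x ∈ intVecToRat d '' t := Set.mem_image_of_mem _ hx
      have hxE := hv.subset_extend (Set.subset_univ _) hxt
      have hlx (i) : l i x =
          N * if (⟨_, hxE⟩ : hv.extend (Set.subset_univ _)) = i then 1 else 0 := by
        have hbx : b ⟨_, hxE⟩ = intVecToRat d x := Module.Basis.extend_apply_self _ _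
        have := hl i x
        rw [← hbx, Module.Basis.coord_apply, Module.Basis.repr_self, Finsupp.single_apply] at this
        exact_mod_cast this
      rcases j with i | i
      · exact ⟨if (⟨_, hxE⟩ : hv.extend (Set.subset_univ _)) = i then 1 else 0, by
          simp [hlx]⟩
      · refine ⟨0, ?_⟩
        simp only [Sum.elim_inr]
        split_ifs with hi
        · simp
        · have : (⟨_, hxE⟩ : hv.extend (Set.subset_univ _)) ≠ i := by
            rintro rfl
            exact hi hxt
          simp [hlx, this]
  · intro hx
    have hu (i) : ∃ u ∈ AddSubmonoid.closure t,
        intVecToRat d u = b.repr (intVecToRat d x) i • b i := by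
      obtain ⟨k, hk⟩ := hx (.inl i)
      have hk : b.repr (intVecToRat d x) i = k := by
        have := hl i x
        simp only [Sum.elim_inl] at hk
        rw [hk, Module.Basis.coord_apply] at this
        push_cast at this
        exact (mul_left_cancel₀ hN' this).symm
      have hbi : b i = i.1 := Module.Basis.extend_apply_self _ _
      by_cases hi : i.1 ∈ intVecToRat d '' t
      · obtain ⟨u, hu, hui⟩ := hi
        exact ⟨k • u, nsmul_mem (mem_closure_of_mem hu) k, by
          rw [map_nsmul, hui, hk, hbi, Nat.cast_smul_eq_nsmul]⟩
      · refine ⟨0, zero_mem _, ?_⟩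
        obtain ⟨k', hk'⟩ := hx (.inr i)
        simp only [Sum.elim_inr, if_neg hi, AddMonoidHom.neg_apply] at hk'
        have h := hl i x
        rw [Module.Basis.coord_apply, hk] at h
        have h' : (-(N * k) : ℚ) = N * k' := by
          rw [← h]
          exact_mod_cast hk'
        have h₀ : -(k : ℚ) = k' := mul_left_cancel₀ hN' (by linear_combination h')
        have h₁ : (0 : ℚ) ≤ k := Nat.cast_nonneg k
        have h₂ : (0 : ℚ) ≤ k' := Nat.cast_nonneg k'
        have h₃ : (k : ℚ) = 0 := by linarith
        rw [hk, h₃, zero_smul, map_zero]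
    choose u hut hu using hu
    have : x = ∑ i, u i := by
      apply intVecToRat_injective
      rw [map_sum]
      simp_rw [hu]
      exact (b.sum_repr _).symm
    rw [this]
    exact sum_mem fun i _ => hut i

theorem FiniteDisjointUnion.sdiff_isProperLinearSet {X L : Set (Fin d → ℤ)}
    (hX : FiniteDisjointUnion IsSliceImage X) (hL : IsProperLinearSet L) :
    FiniteDisjointUnion IsSliceImage (X \ L) := by
  obtain ⟨a, t, -, ht, rfl⟩ := hL
  obtain ⟨J, _, l, N, hN, h⟩ := exists_closure_eq_iInter_progressionPreimage ht
  convert! hX.sdiff_iInter_progressionPreimage l (fun j => l j a) hN Finset.univ using 2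
  ext x
  simp only [Set.mem_vadd_set_iff_neg_vadd_mem, h, Set.mem_iInter, progressionPreimage,
    Set.mem_ofPred_eq, vadd_eq_add, map_add, map_neg, Finset.mem_univ, forall_true_left]
  refine forall_congr' fun j => exists_congr fun k => ?_
  constructor <;> intro h <;> linarith

end ProperLinear

/-- Every semilinear set of `ℤ ^ d` is a finite disjoint union of linear sets. -/
theorem IsSemilinearSet.finiteDisjointUnion {d : ℕ} {X : Set (Fin d → ℤ)}
    (hX : IsSemilinearSet X) : FiniteDisjointUnion IsLinearSet X := by
  have : AddMonoid.FG (Fin d → ℤ) := inferInstance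
  obtain ⟨S, hS, hS', hXS⟩ := hX.compl.isProperSemilinearSet
  refine FiniteDisjointUnion.bind (P := IsSliceImage) ?_ fun Y hY => hY.finiteDisjointUnion
  rw [← compl_compl X, hXS, Set.compl_eq_univ_sdiff]
  clear hXS
  induction S, hS using Set.Finite.induction_on with
  | empty => simpa using finiteDisjointUnion_isSliceImage_univ d
  | @insert L S _ _ ih =>
    rw [Set.sUnion_insert, Set.union_comm, ← Set.sdiff_sdiff]
    exact (ih fun t ht => hS' t (by simp [ht])).sdiff_isProperLinearSet (hS' L (by simp))

/-! ### Affine stratifications -/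

theorem IsAffineStratification.isSemilinearSet {d : ℕ} {W : Set (Fin d → ℤ)}
    (hW : IsAffineStratification W) : IsSemilinearSet W := by
  obtain ⟨r, F, A, hA, -, rfl⟩ := hW
  exact .iUnion fun i => (IsSemilinearSet.of_finite (F i).finite_toSet).add (.of_fg (hA i))

theorem FiniteDisjointUnion.isAffineStratification {d : ℕ} {W : Set (Fin d → ℤ)}
    (hW : FiniteDisjointUnion IsLinearSet W) : IsAffineStratification W := by
  induction hW with
  | empty => exact ⟨0, Fin.elim0, Fin.elim0, fun i => i.elim0, fun i => i.elim0, by simp⟩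
  | cons hL _ hd ih =>
    obtain ⟨r, F, A, hA, hFA, rfl⟩ := ih
    obtain ⟨a, P, hP, rfl⟩ := isLinearSet_iff_exists_fg_eq_vadd.1 hL
    have haP : (({a} : Finset (Fin d → ℤ)) : Set (Fin d → ℤ)) + (P : Set (Fin d → ℤ)) =
        a +ᵥ (P : Set (Fin d → ℤ)) := by
      rw [Finset.coe_singleton, Set.singleton_add]
      rfl
    rw [Set.disjoint_iUnion_right] at hd
    refine ⟨r + 1, Fin.cons {a} F, Fin.cons P A, Fin.cases hP hA, ?_, ?_⟩
    · intro i j hij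
      cases i using Fin.cases with
      | zero =>
        cases j using Fin.cases with
        | zero => exact absurd rfl hij
        | succ j => simpa only [Fin.cons_zero, Fin.cons_succ, haP] using hd j
      | succ i =>
        cases j using Fin.cases with
        | zero => simpa only [Fin.cons_zero, Fin.cons_succ, haP] using (hd i).symm
        | succ j =>
          simpa only [Fin.cons_succ] using hFA fun h => hij (congrArg Fin.succ h)
    · ext x
      simp only [Set.mem_union, Set.mem_iUnion, Fin.exists_fin_succ, Fin.cons_zero, Fin.cons_succ,
        haP]

/-- If each of finitely many subsets of `ℤ^d` possesses an affine stratification,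
then so does their union. -/
theorem union_isAffineStratification {d n : ℕ}
    (W : Fin n → Set (Fin d → ℤ)) (hW : ∀ i, IsAffineStratification (W i)) :
    IsAffineStratification (⋃ i, W i) :=
  (IsSemilinearSet.iUnion fun i =>
    (hW i).isSemilinearSet).finiteDisjointUnion.isAffineStratification
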